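/- Let p > 1 and let f be a probability density on ℝ that is C^∞, strictly positive, decays together with all its derivatives faster than any polynomial as |x| → ∞, and has finite second moment Θ₀ = ∫_ℝ x² f dx > 0. Let B be the Barenblatt profile of unit mass and second moment Θ₀. Then the following Gagliardo–Nirenberg-type inequality with explicit Barenblatt constant holds: (∫_ℝ f^p dx)^{2p/(p−1)} · I_p(B) ≤ (∫_ℝ B^p dx)^{2p/(p−1)} · I_p(f). -/

import Mathlib

open MeasureTheory Filter Set

/-- The `p`-logarithm: `ln_p u = (u^(p-1) - 1)/(p-1)` for `p ≠ 1`, and `ln u` for `p = 1`. -/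
noncomputable def lnp (p : ℝ) (u : ℝ) : ℝ :=
  if p = 1 then Real.log u else (u ^ (p - 1) - 1) / (p - 1)

/-- Generalized Fisher information `I_p(f) = (1/2) ∫ f ((ln_p f)')²`. -/
noncomputable def fisherP (p : ℝ) (f : ℝ → ℝ) : ℝ :=
  (1 / 2) * ∫ x : ℝ, f x * (deriv (fun y => lnp p (f y)) x) ^ 2

/-- Rényi entropy of order `p ≠ 1`: `R_p(f) = (1/(1-p)) ln ∫ f^p`. -/
noncomputable def renyi (p : ℝ) (f : ℝ → ℝ) : ℝ :=
  (1 / (1 - p)) * Real.log (∫ x : ℝ, f x ^ p)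

/-- `f`, together with all its derivatives, decays faster than any polynomial at infinity. -/
def RapidDecay (f : ℝ → ℝ) : Prop :=
  ∀ n k : ℕ, Tendsto (fun x => x ^ n * iteratedDeriv k f x) (cocompact ℝ) (nhds 0)

namespace RapidDecay

variable {f : ℝ → ℝ}

theorem exists_abs_le (hf : RapidDecay f) (hsmooth : ContDiff ℝ (⊤ : ℕ∞) f) (n k : ℕ) :
    ∃ A, ∀ x, |x ^ n * iteratedDeriv k f x| ≤ A := by
  have hc : Continuous fun x => x ^ n * iteratedDeriv k f x :=
    (continuous_pow n).mul (hsmooth.continuous_iteratedDeriv k (by exact_mod_cast le_top))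
  let g : ZeroAtInftyContinuousMap ℝ ℝ := ⟨⟨_, hc⟩, hf n k⟩
  exact ⟨‖g.toBCF‖, fun x => g.toBCF.norm_coe_le_norm x⟩

theorem integrable_rpow (hf : RapidDecay f) (hsmooth : ContDiff ℝ (⊤ : ℕ∞) f)
    (hpos : ∀ x, 0 < f x) {q : ℝ} (hq : 0 < q) : Integrable fun x => f x ^ q := by
  obtain ⟨n, hn⟩ := exists_nat_gt (1 / q)
  obtain ⟨A₀, hA₀⟩ := hf.exists_abs_le hsmooth 0 0
  obtain ⟨A₁, hA₁⟩ := hf.exists_abs_le hsmooth n 0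
  have hnq : 1 < n * q := by rwa [div_lt_iff₀ hq] at hn
  have hint : Integrable fun x : ℝ => (1 + ‖x‖) ^ (-(n * q)) :=
    integrable_one_add_norm (by simpa using hnq)
  refine (hint.const_mul ((2 ^ (n - 1) * (A₀ + A₁)) ^ q)).mono'
    (hsmooth.continuous.rpow_const fun x => Or.inl (hpos x).ne').aestronglyMeasurable
    (Eventually.of_forall fun x => ?_)
  have hx : 0 < 1 + ‖x‖ := by positivity
  have h₀ : f x ≤ A₀ := by simpa using (le_abs_self _).trans (hA₀ x)
  have h₁ : ‖x‖ ^ n * f x ≤ A₁ := by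
    have := hA₁ x
    rwa [iteratedDeriv_zero, abs_mul, abs_pow, abs_of_pos (hpos x)] at this
  have hle : f x * (1 + ‖x‖) ^ n ≤ 2 ^ (n - 1) * (A₀ + A₁) := by
    have h := add_pow_le (zero_le_one (α := ℝ)) (norm_nonneg x) n
    calc f x * (1 + ‖x‖) ^ n ≤ f x * (2 ^ (n - 1) * (1 ^ n + ‖x‖ ^ n)) :=
          mul_le_mul_of_nonneg_left h (hpos x).le
      _ = 2 ^ (n - 1) * (f x + ‖x‖ ^ n * f x) := by ring
      _ ≤ _ := by gcongr
  have hpow := Real.rpow_le_rpow (by have := hpos x; positivity) hle hq.le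
  rw [Real.mul_rpow (hpos x).le (by positivity), ← Real.rpow_natCast, ← Real.rpow_mul hx.le]
    at hpow
  rw [Real.norm_of_nonneg (by have := hpos x; positivity), Real.rpow_neg hx.le,
    ← div_eq_mul_inv, le_div_iff₀ (by positivity)]
  exact hpow

end RapidDecay

theorem sq_deriv_le_of_deriv_deriv_le {f : ℝ → ℝ} (hf : Differentiable ℝ f)
    (hf' : Differentiable ℝ (deriv f)) (hnonneg : ∀ x, 0 ≤ f x) {S : ℝ}
    (hS : ∀ x, deriv (deriv f) x ≤ S) (x : ℝ) : deriv f x ^ 2 ≤ 2 * S * f x := by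
  set g : ℝ → ℝ := fun z => S / 2 * z ^ 2 - f z with hg
  have hg' : ∀ z, HasDerivAt g (S * z - deriv f z) z := fun z => by
    have := ((hasDerivAt_pow 2 z).const_mul (S / 2)).sub (hf z).hasDerivAt
    refine this.congr_deriv ?_
    norm_num
    ring
  have hdg : deriv g = fun z => S * z - deriv f z := funext fun z => (hg' z).deriv
  have hg'' : ∀ z, HasDerivAt (deriv g) (S - deriv (deriv f) z) z := fun z => by
    rw [hdg]
    exact (((hasDerivAt_id z).const_mul S).sub (hf' z).hasDerivAt).congr_deriv (by simp)
  have hconv : ConvexOn ℝ univ g :=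
    convexOn_univ_of_deriv2_nonneg (fun z => (hg' z).differentiableAt)
      (fun z => (hg'' z).differentiableAt) fun z => by
        change 0 ≤ deriv (deriv g) z
        rw [(hg'' z).deriv]
        linarith [hS z]
  have htangent : ∀ y, g x + deriv g x * (y - x) ≤ g y := fun y => by
    rcases lt_trichotomy x y with h | h | h
    · have := hconv.deriv_le_slope (mem_univ x) (mem_univ y) h (hg' x).differentiableAt
      rw [slope_def_field, le_div_iff₀ (by linarith)] at this
      linarith
    · simp [h]
    · have := hconv.slope_le_deriv (mem_univ y) (mem_univ x) h (hg' x).differentiableAt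
      rw [slope_def_field, div_le_iff₀ (by linarith)] at this
      linarith
  have hquad : ∀ h : ℝ, 0 ≤ S / 2 * (h * h) + deriv f x * h + f x := fun h => by
    have h₁ := htangent (x + h)
    have h₂ := hnonneg (x + h)
    rw [hdg] at h₁
    simp only [hg] at h₁
    nlinarith
  have := discrim_le_zero hquad
  rw [discrim] at this
  linarith

/-- The kernel `s ↦ s^(p-1) √(1 - s^(p-1))`, for which
`f^(p-1) √(M^(p-1) - f^(p-1))` is a rescaling of `barenblattKernel p (f / M)`. -/
noncomputable def barenblattKernel (p s : ℝ) : ℝ := s ^ (p - 1) * √(1 - s ^ (p - 1))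

/-- The primitive of `barenblattKernel p` vanishing at `0`. -/
noncomputable def barenblattPrimitive (p u : ℝ) : ℝ := ∫ s in (0 : ℝ)..u, barenblattKernel p s

theorem continuous_barenblattKernel {p : ℝ} (hp : 1 < p) : Continuous (barenblattKernel p) := by
  have : Continuous fun s : ℝ => s ^ (p - 1) := Real.continuous_rpow_const (by linarith)
  unfold barenblattKernel
  fun_prop

theorem hasDerivAt_barenblattPrimitive {p : ℝ} (hp : 1 < p) (u : ℝ) :
    HasDerivAt (barenblattPrimitive p) (barenblattKernel p u) u :=
  ((continuous_barenblattKernel hp).integral_hasStrictDerivAt 0 u).hasDerivAt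

theorem continuous_barenblattPrimitive {p : ℝ} (hp : 1 < p) : Continuous (barenblattPrimitive p) :=
  continuous_iff_continuousAt.2 fun u => (hasDerivAt_barenblattPrimitive hp u).continuousAt

theorem barenblattPrimitive_zero (p : ℝ) : barenblattPrimitive p 0 = 0 := by
  simp [barenblattPrimitive]

theorem deriv_lnp_comp {p : ℝ} (hp : 1 < p) {f : ℝ → ℝ} {x : ℝ} (hpos : 0 < f x)
    (hf : DifferentiableAt ℝ f x) :
    deriv (fun y => lnp p (f y)) x = f x ^ (p - 1) / f x * deriv f x := by
  have hp' : p - 1 ≠ 0 := by linarith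
  simp only [lnp, if_neg hp.ne']
  refine ((((hf.hasDerivAt.rpow_const (p := p - 1) (Or.inl hpos.ne')).sub_const 1).div_const
    (p - 1)).congr_deriv ?_).deriv
  rw [Real.rpow_sub_one hpos.ne']
  field_simp

theorem RapidDecay.integrable_fisher {p : ℝ} (hp : 1 < p) {f : ℝ → ℝ} (hf : RapidDecay f)
    (hsmooth : ContDiff ℝ (⊤ : ℕ∞) f) (hpos : ∀ x, 0 < f x) :
    Integrable fun x => f x * deriv (fun y => lnp p (f y)) x ^ 2 := by
  have hdiff : Differentiable ℝ f := hsmooth.differentiable (by simp)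
  have hdiff' : Differentiable ℝ (deriv f) := by
    simpa using hsmooth.differentiable_iteratedDeriv 1 (by exact_mod_cast ENat.natCast_lt_top 1)
  obtain ⟨S, hS⟩ := hf.exists_abs_le hsmooth 0 2
  have hsq := sq_deriv_le_of_deriv_deriv_le hdiff hdiff' (fun x => (hpos x).le) (S := S)
    fun x => by simpa [iteratedDeriv_succ] using (le_abs_self _).trans (hS x)
  simp only [fun x => deriv_lnp_comp hp (hpos x) (hdiff x)]
  have hcont : Continuous fun x => f x * (f x ^ (p - 1) / f x * deriv f x) ^ 2 := by
    have h₁ : Continuous fun x => f x ^ (p - 1) :=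
      hdiff.continuous.rpow_const fun x => Or.inl (hpos x).ne'
    exact hdiff.continuous.mul
      (((h₁.div hdiff.continuous fun x => (hpos x).ne').mul hdiff'.continuous).pow 2)
  refine ((hf.integrable_rpow hsmooth hpos (q := (p - 1) * 2) (by linarith)).const_mul
    (2 * S)).mono' hcont.aestronglyMeasurable (Eventually.of_forall fun x => ?_)
  have hx := hpos x
  rw [Real.norm_of_nonneg (by positivity), Real.rpow_mul hx.le, Real.rpow_two]
  calc f x * (f x ^ (p - 1) / f x * deriv f x) ^ 2
      = (f x ^ (p - 1)) ^ 2 / f x * deriv f x ^ 2 := by field_simp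
    _ ≤ (f x ^ (p - 1)) ^ 2 / f x * (2 * S * f x) := by gcongr; exact hsq x
    _ = _ := by field_simp

theorem two_mul_barenblattKernel_mul_le {p M u : ℝ} (hp : 1 < p) (hu : 0 < u) (huM : u ≤ M)
    (l d : ℝ) :
    2 * l * (M * M ^ (p - 1) * √(M ^ (p - 1))) * (barenblattKernel p (u / M) * (d / M)) ≤
      u * (u ^ (p - 1) / u * d) ^ 2 + l ^ 2 * (M ^ (p - 1) * u - u ^ p) := by
  have hM : 0 < M := hu.trans_le huM
  have hpow : u ^ p = u ^ (p - 1) * u := by rw [Real.rpow_sub_one hu.ne']; field_simp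
  have hle : u ^ (p - 1) ≤ M ^ (p - 1) := Real.rpow_le_rpow hu.le huM (by linarith)
  have hq : 0 < u ^ (p - 1) := by positivity
  have ht : 0 < M ^ (p - 1) := by positivity
  rw [barenblattKernel, Real.div_rpow hu.le hM.le, hpow]
  generalize u ^ (p - 1) = q at *
  generalize M ^ (p - 1) = t at *
  have hsqrt : √t * √(1 - q / t) = √(t - q) := by
    rw [← Real.sqrt_mul ht.le]
    congr 1
    field_simp
  have hlhs : 2 * l * (M * t * √t) * (q / t * √(1 - q / t) * (d / M)) =
      2 * l * q * d * √(t - q) := by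
    rw [← hsqrt]
    field_simp
  have hrhs : u * (q / u * d) ^ 2 + l ^ 2 * (t * u - q * u) =
      (√u * (q / u * d)) ^ 2 + (l * √u * √(t - q)) ^ 2 := by
    simp only [mul_pow]
    rw [Real.sq_sqrt hu.le, Real.sq_sqrt (sub_nonneg.2 hle)]
    ring
  have hmul : 2 * l * q * d * √(t - q) = 2 * (√u * (q / u * d)) * (l * √u * √(t - q)) := by
    have := Real.mul_self_sqrt hu.le
    calc _ = 2 * l * q * d * √(t - q) * ((√u * √u) / u) := by rw [this]; field_simp
      _ = _ := by ring
  rw [hlhs, hrhs, hmul]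
  exact two_mul_le_add_sq _ _

/-- The sharp inequality relating the Fisher information, the mass and the maximum of a density;
it is an equality for Barenblatt profiles. -/
theorem RapidDecay.le_fisher_mul {p : ℝ} (hp : 1 < p) {f : ℝ → ℝ} (hf : RapidDecay f)
    (hsmooth : ContDiff ℝ (⊤ : ℕ∞) f) (hpos : ∀ x, 0 < f x) (hfint : Integrable f)
    (hfmass : ∫ x, f x = 1) {x₀ : ℝ} (hx₀ : ∀ x, f x ≤ f x₀) :
    4 * barenblattPrimitive p 1 ^ 2 * (f x₀ ^ 2 * (f x₀ ^ (p - 1)) ^ 3) ≤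
      (∫ x, f x * deriv (fun y => lnp p (f y)) x ^ 2) * (f x₀ ^ (p - 1) - ∫ x, f x ^ p) := by
  have hdiff : Differentiable ℝ f := hsmooth.differentiable (by simp)
  have hM : 0 < f x₀ := hpos x₀
  have hWint := hf.integrable_fisher hp hsmooth hpos
  have hpint : Integrable fun x => f x ^ p := hf.integrable_rpow hsmooth hpos (by linarith)
  set M := f x₀
  set t := M ^ (p - 1)
  have ht : 0 < t := by positivity
  set W : ℝ → ℝ := fun x => f x * deriv (fun y => lnp p (f y)) x ^ 2
  set V : ℝ → ℝ := fun x => t * f x - f x ^ p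
  set G' : ℝ → ℝ := fun x => barenblattKernel p (f x / M) * (deriv f x / M)
  set K := M * t * √t
  set η := barenblattPrimitive p 1
  have hK : 0 < K := by positivity
  have hVint : Integrable V := (hfint.const_mul t).sub hpint
  have hVval : ∫ x, V x = t - ∫ x, f x ^ p := by
    rw [integral_sub (hfint.const_mul t) hpint, integral_const_mul, hfmass, mul_one]
  have hpt : ∀ l x, 2 * l * K * G' x ≤ W x + l ^ 2 * V x := fun l x => by
    simp only [W, V, deriv_lnp_comp hp (hpos x) (hdiff x)]
    exact two_mul_barenblattKernel_mul_le hp (hpos x) (hx₀ x) l _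
  have hG : ∀ x, HasDerivAt (fun y => barenblattPrimitive p (f y / M)) (G' x) x := fun x =>
    (hasDerivAt_barenblattPrimitive hp _).comp x ((hdiff x).hasDerivAt.div_const M)
  have hG'cont : Continuous G' :=
    ((continuous_barenblattKernel hp).comp (hdiff.continuous.div_const M)).mul
      ((hsmooth.continuous_deriv (by simp)).div_const M)
  have hG'int : Integrable G' := by
    refine ((hWint.add (hVint.const_mul 1)).const_mul (2 * K)⁻¹).mono'
      hG'cont.aestronglyMeasurable (Eventually.of_forall fun x => ?_)
    have h₁ := hpt 1 x
    have h₂ := hpt (-1) x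
    simp only [Pi.add_apply]
    rw [Real.norm_eq_abs, ← div_eq_inv_mul, le_div_iff₀ (by positivity)]
    rcases abs_cases (G' x) with ⟨h, -⟩ | ⟨h, -⟩ <;> rw [h] <;> linarith
  have hlim : Tendsto (fun x => barenblattPrimitive p (f x / M)) (cocompact ℝ) (nhds 0) := by
    have h := (hf 0 0).div_const M
    simp only [pow_zero, one_mul, iteratedDeriv_zero, zero_div] at h
    simpa [barenblattPrimitive_zero, Function.comp_def] using
      ((continuous_barenblattPrimitive hp).tendsto 0).comp h
  have hleft : ∫ x in Iic x₀, G' x = η := by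
    rw [integral_Iic_of_hasDerivAt_of_tendsto' (fun x _ => hG x) hG'int.integrableOn
      (hlim.mono_left atBot_le_cocompact), div_self hM.ne', sub_zero]
  have hright : ∫ x in Ioi x₀, G' x = -η := by
    rw [integral_Ioi_of_hasDerivAt_of_tendsto' (fun x _ => hG x) hG'int.integrableOn
      (hlim.mono_left atTop_le_cocompact), div_self hM.ne', zero_sub]
  have hset : ∀ (s : Set ℝ) (l : ℝ),
      2 * l * K * ∫ x in s, G' x ≤ ∫ x in s, (W x + l ^ 2 * V x) := fun s l => by
    rw [← integral_const_mul]
    exact integral_mono (hG'int.integrableOn.const_mul _)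
      (hWint.add (hVint.const_mul _)).integrableOn (hpt l)
  have hquad : ∀ l : ℝ, 0 ≤ (∫ x, V x) * (l * l) + (-(4 * K * η)) * l + ∫ x, W x := fun l => by
    have h₁ := hset (Iic x₀) l
    have h₂ := hset (Ioi x₀) (-l)
    rw [neg_sq] at h₂
    have h₃ := integral_add_compl (measurableSet_Iic (a := x₀)) (hWint.add (hVint.const_mul (l ^ 2)))
    simp only [compl_Iic, Pi.add_apply] at h₃
    rw [integral_add hWint (hVint.const_mul _), integral_const_mul] at h₃
    rw [hleft] at h₁
    rw [hright] at h₂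
    linarith
  have hd := discrim_le_zero hquad
  have hK2 : K ^ 2 = M ^ 2 * t ^ 3 := by
    simp only [K, mul_pow, Real.sq_sqrt ht.le]
    ring
  rw [discrim, hVval, neg_sq, mul_pow, mul_pow, hK2] at hd
  linarith

/-- The Barenblatt profile `y ↦ (C - k y²)₊^(1/(p-1))`. -/
noncomputable def barenblatt (p C k y : ℝ) : ℝ := max (C - k * y ^ 2) 0 ^ (1 / (p - 1))

section Barenblatt

variable {p C k : ℝ}

theorem barenblatt_nonneg (y : ℝ) : 0 ≤ barenblatt p C k y :=
  Real.rpow_nonneg (le_max_right _ _) _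

theorem barenblatt_rpow_sub_one (hp : 1 < p) (y : ℝ) :
    barenblatt p C k y ^ (p - 1) = max (C - k * y ^ 2) 0 := by
  have : p - 1 ≠ 0 := by linarith
  rw [barenblatt, ← Real.rpow_mul (le_max_right _ _), one_div_mul_cancel this, Real.rpow_one]

theorem barenblatt_eq_zero (hp : 1 < p) {y : ℝ} (hy : C - k * y ^ 2 ≤ 0) :
    barenblatt p C k y = 0 := by
  have : p - 1 ≠ 0 := by linarith
  rw [barenblatt, max_eq_right hy, Real.zero_rpow (by positivity)]

theorem barenblatt_pos {y : ℝ} (hy : 0 < C - k * y ^ 2) : 0 < barenblatt p C k y :=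
  Real.rpow_pos_of_pos (lt_max_of_lt_left hy) _

theorem barenblatt_neg (y : ℝ) : barenblatt p C k (-y) = barenblatt p C k y := by
  simp [barenblatt]

theorem barenblatt_rpow (hp : 1 < p) (y : ℝ) :
    barenblatt p C k y ^ p = C * barenblatt p C k y - k * (y ^ 2 * barenblatt p C k y) := by
  rcases le_or_gt (C - k * y ^ 2) 0 with hy | hy
  · rw [barenblatt_eq_zero hp hy, Real.zero_rpow (by linarith)]
    ring
  · have hB := barenblatt_pos (p := p) hy
    have h := barenblatt_rpow_sub_one (C := C) (k := k) hp y
    rw [max_eq_left hy.le, Real.rpow_sub_one hB.ne', div_eq_iff hB.ne'] at h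
    rw [h]
    ring

theorem continuous_barenblatt (hp : 1 < p) : Continuous (barenblatt p C k) := by
  have : 0 ≤ 1 / (p - 1) := one_div_nonneg.2 (by linarith)
  exact Continuous.rpow_const (by fun_prop) fun _ => Or.inr this

theorem hasDerivAt_barenblatt {y : ℝ} (hy : 0 < C - k * y ^ 2) :
    HasDerivAt (barenblatt p C k)
      (-(2 * k / (p - 1) * y) * (barenblatt p C k y / (C - k * y ^ 2))) y := by
  have h : HasDerivAt (fun z : ℝ => C - k * z ^ 2) (-(2 * k * y)) y := by
    refine (((hasDerivAt_pow 2 y).const_mul k).const_sub C).congr_deriv ?_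
    norm_num
    ring
  have heq : barenblatt p C k =ᶠ[nhds y] fun z => (C - k * z ^ 2) ^ (1 / (p - 1)) := by
    filter_upwards [h.continuousAt.eventually (lt_mem_nhds hy)] with z hz
    rw [barenblatt, max_eq_left (le_of_lt hz)]
  refine ((h.rpow_const (Or.inl hy.ne')).congr_of_eventuallyEq heq).congr_deriv ?_
  rw [barenblatt, max_eq_left hy.le, Real.rpow_sub_one hy.ne']
  ring

theorem support_barenblatt_subset (hp : 1 < p) (hk : 0 < k) :
    Function.support (barenblatt p C k) ⊆ Ioc (-√(C / k)) √(C / k) := fun y hy => by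
  have hy : 0 < C - k * y ^ 2 := not_le.1 fun h => hy (barenblatt_eq_zero hp h)
  have : |y| < √(C / k) := Real.lt_sqrt_of_sq_lt (by rw [sq_abs, lt_div_iff₀ hk]; linarith)
  exact ⟨(abs_lt.1 this).1, (abs_lt.1 this).2.le⟩

theorem sub_mul_sq_pos_of_abs_lt (hk : 0 < k) {y : ℝ} (hy : |y| < √(C / k)) :
    0 < C - k * y ^ 2 := by
  have := (Real.lt_sqrt (abs_nonneg y)).1 hy
  rw [sq_abs, lt_div_iff₀ hk] at this
  linarith

theorem sub_mul_sqrt_sq (hC : 0 < C) (hk : 0 < k) : C - k * √(C / k) ^ 2 = 0 := by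
  rw [Real.sq_sqrt (by positivity)]
  field_simp
  ring

theorem integral_fisher_barenblatt (hp : 1 < p) :
    ∫ y, barenblatt p C k y * deriv (fun z => lnp p (barenblatt p C k z)) y ^ 2 =
      4 * k ^ 2 / (p - 1) ^ 2 * ∫ y, y ^ 2 * barenblatt p C k y := by
  have hp' : p - 1 ≠ 0 := by linarith
  rw [← integral_const_mul]
  congr 1 with y
  rcases le_or_gt (C - k * y ^ 2) 0 with hy | hy
  · simp [barenblatt_eq_zero hp hy]
  · have hB := barenblatt_pos (p := p) hy
    have hd := hasDerivAt_barenblatt (p := p) hy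
    rw [deriv_lnp_comp hp hB hd.differentiableAt, hd.deriv, barenblatt_rpow_sub_one hp,
      max_eq_left hy.le]
    field_simp
    ring

theorem integral_barenblatt_rpow_eq_sub (hp : 1 < p) (hB : Integrable (barenblatt p C k))
    (hB₂ : Integrable fun y => y ^ 2 * barenblatt p C k y) :
    ∫ y, barenblatt p C k y ^ p =
      C * (∫ y, barenblatt p C k y) - k * ∫ y, y ^ 2 * barenblatt p C k y := by
  simp only [barenblatt_rpow hp]
  rw [integral_sub (hB.const_mul _) (hB₂.const_mul _), integral_const_mul, integral_const_mul]

theorem integral_barenblatt_rpow (hp : 1 < p) (hC : 0 < C) (hk : 0 < k) :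
    ∫ y, barenblatt p C k y ^ p = 2 * p * k / (p - 1) * ∫ y, y ^ 2 * barenblatt p C k y := by
  have hp' : p - 1 ≠ 0 := by linarith
  have hsupp := support_barenblatt_subset (C := C) hp hk
  have hBc := continuous_barenblatt (C := C) (k := k) hp
  have hBp : Continuous fun y => barenblatt p C k y ^ p :=
    hBc.rpow_const fun _ => Or.inr (by linarith)
  have hB₂ : Continuous fun y => y ^ 2 * barenblatt p C k y := (continuous_pow 2).mul hBc
  have h₁ : Function.support (fun y => barenblatt p C k y ^ p) ⊆ Ioc (-√(C / k)) √(C / k) :=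
    fun y hy => hsupp fun h => hy (by simp only [h]; exact Real.zero_rpow (by linarith))
  have h₂ : Function.support (fun y => y ^ 2 * barenblatt p C k y) ⊆ Ioc (-√(C / k)) √(C / k) :=
    (Function.support_mul_subset_right _ _).trans hsupp
  rw [← intervalIntegral.integral_eq_integral_of_support_subset h₁,
    ← intervalIntegral.integral_eq_integral_of_support_subset h₂]
  have hftc := intervalIntegral.integral_eq_sub_of_hasDerivAt_of_le
    (a := -√(C / k)) (b := √(C / k)) (f := fun y => y * barenblatt p C k y ^ p)
    (f' := fun y => barenblatt p C k y ^ p -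
      2 * p * k / (p - 1) * (y ^ 2 * barenblatt p C k y))
    (by linarith [Real.sqrt_nonneg (C / k)]) (continuous_id.mul hBp).continuousOn
    (fun y hy => by
      have hm := sub_mul_sq_pos_of_abs_lt hk (abs_lt.2 hy)
      have hB := barenblatt_pos (p := p) hm
      refine ((hasDerivAt_id y).mul
        ((hasDerivAt_barenblatt hm).rpow_const (p := p) (Or.inl hB.ne'))).congr_deriv ?_
      rw [barenblatt_rpow_sub_one hp, max_eq_left hm.le]
      simp only [id]
      generalize C - k * y ^ 2 = m at hm
      field_simp
      ring)
    ((hBp.sub (hB₂.const_mul _)).intervalIntegrable _ _)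
  have hzero := sub_mul_sqrt_sq hC hk
  rw [intervalIntegral.integral_sub (hBp.intervalIntegrable _ _)
    ((hB₂.const_mul _).intervalIntegrable _ _), intervalIntegral.integral_const_mul,
    barenblatt_neg, barenblatt_eq_zero hp hzero.le, Real.zero_rpow (by linarith)] at hftc
  linarith

theorem two_mul_barenblattPrimitive_one (hp : 1 < p) (hC : 0 < C) (hk : 0 < k) :
    2 * barenblattPrimitive p 1 =
      2 * k / (p - 1) * √(k / C) / (C * barenblatt p C k 0) *
        ∫ y, y ^ 2 * barenblatt p C k y := by
  have hp' : p - 1 ≠ 0 := by linarith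
  have hsupp := support_barenblatt_subset (C := C) hp hk
  have hBc := continuous_barenblatt (C := C) (k := k) hp
  have hB₂ : Continuous fun y => y ^ 2 * barenblatt p C k y := (continuous_pow 2).mul hBc
  have hM : 0 < barenblatt p C k 0 := barenblatt_pos (by simpa using hC)
  have hMC : barenblatt p C k 0 ^ (p - 1) = C := by
    simp [barenblatt_rpow_sub_one hp, hC.le]
  have hfull : ∫ y, y ^ 2 * barenblatt p C k y =
      2 * ∫ y in (0 : ℝ)..√(C / k), y ^ 2 * barenblatt p C k y := by
    rw [← intervalIntegral.integral_eq_integral_of_support_subset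
      ((Function.support_mul_subset_right _ _).trans hsupp),
      ← intervalIntegral.integral_add_adjacent_intervals (b := 0) (hB₂.intervalIntegrable _ _)
        (hB₂.intervalIntegrable _ _), two_mul]
    congr 1
    rw [← neg_zero, ← intervalIntegral.integral_comp_neg, neg_zero]
    simp only [barenblatt_neg, neg_sq]
  have hftc := intervalIntegral.integral_eq_sub_of_hasDerivAt_of_le
    (a := 0) (b := √(C / k))
    (f := fun y => barenblattPrimitive p (barenblatt p C k y / barenblatt p C k 0))
    (f' := fun y => -(2 * k / (p - 1) * √(k / C) / (C * barenblatt p C k 0)) *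
      (y ^ 2 * barenblatt p C k y))
    (Real.sqrt_nonneg _)
    ((continuous_barenblattPrimitive hp).comp (hBc.div_const _)).continuousOn
    (fun y hy => by
      have hm := sub_mul_sq_pos_of_abs_lt hk (by rw [abs_of_pos hy.1]; exact hy.2)
      refine ((hasDerivAt_barenblattPrimitive hp _).comp y
        ((hasDerivAt_barenblatt hm).div_const _)).congr_deriv ?_
      have hs : √(1 - (C - k * y ^ 2) / C) = √(k / C) * y := by
        rw [show 1 - (C - k * y ^ 2) / C = k / C * y ^ 2 by field_simp; ring,
          Real.sqrt_mul (by positivity), Real.sqrt_sq hy.1.le]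
      rw [barenblattKernel, Real.div_rpow (barenblatt_nonneg y) hM.le,
        barenblatt_rpow_sub_one hp, hMC, max_eq_left hm.le, hs]
      field_simp)
    ((hB₂.const_mul _).intervalIntegrable _ _)
  have hzero := sub_mul_sqrt_sq hC hk
  rw [intervalIntegral.integral_const_mul, barenblatt_eq_zero hp hzero.le, zero_div,
    barenblattPrimitive_zero, div_self hM.ne'] at hftc
  rw [hfull]
  linarith

theorem fisher_barenblatt_mul (hp : 1 < p) (hC : 0 < C) (hk : 0 < k)
    (hB : Integrable (barenblatt p C k)) (hmass : ∫ y, barenblatt p C k y = 1)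
    (hB₂ : Integrable fun y => y ^ 2 * barenblatt p C k y) :
    (∫ y, barenblatt p C k y * deriv (fun z => lnp p (barenblatt p C k z)) y ^ 2) *
        (C - ∫ y, barenblatt p C k y ^ p) =
      4 * barenblattPrimitive p 1 ^ 2 * (barenblatt p C k 0 ^ 2 * C ^ 3) := by
  have hp' : p - 1 ≠ 0 := by linarith
  have hM : 0 < barenblatt p C k 0 := barenblatt_pos (by simpa using hC)
  have hη : 4 * barenblattPrimitive p 1 ^ 2 = (2 * barenblattPrimitive p 1) ^ 2 := by ring
  have hs : √(k / C) ^ 2 = k / C := Real.sq_sqrt (by positivity)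
  rw [hη, two_mul_barenblattPrimitive_one hp hC hk, integral_fisher_barenblatt hp,
    integral_barenblatt_rpow_eq_sub hp hB hB₂, hmass]
  simp only [mul_pow, div_pow, hs]
  field_simp
  ring

end Barenblatt

theorem sq_mul_rpow_sub_one_pow {p M : ℝ} (hp : 1 < p) (hM : 0 < M) :
    M ^ 2 * (M ^ (p - 1)) ^ 3 = (M ^ (p - 1)) ^ (2 * p / (p - 1) + 1) := by
  have hp' : p - 1 ≠ 0 := by linarith
  rw [← Real.rpow_natCast, ← Real.rpow_natCast, ← Real.rpow_mul hM.le, ← Real.rpow_mul hM.le,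
    ← Real.rpow_add hM]
  congr 1
  push_cast
  field_simp
  ring

/-- If `E (t - P) ≥ N t^(b+1)` with equality for `(E', t', P')`, and `P'` maximizes
`P ↦ P^b (t' - P)`, then `E / P^b` is at least `E' / P'^b`. -/
theorem rpow_mul_le_rpow_mul_of_le_mul_sub {b N E t P E' t' P' : ℝ} (hb : 0 < b) (hP : 0 < P)
    (hP' : 0 < P') (hE' : 0 < E') (ht : 0 < t) (htP : P ≤ t) (ht' : b * (t' - P') = P')
    (h : N * t ^ (b + 1) ≤ E * (t - P)) (h' : E' * (t' - P') = N * t' ^ (b + 1)) :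
    P ^ b * E' ≤ P' ^ b * E := by
  have hsub : 0 < t' - P' := pos_of_mul_pos_right (ht'.symm ▸ hP' : 0 < b * (t' - P')) hb.le
  have ht'pos : 0 < t' := by linarith
  have hN : 0 < N := by
    have : 0 < N * t' ^ (b + 1) := h' ▸ mul_pos hE' hsub
    exact pos_of_mul_pos_left this (by positivity)
  have htP : P < t := by
    refine htP.lt_of_ne fun heq => ?_
    have : 0 < N * t ^ (b + 1) := by positivity
    rw [heq, sub_self, mul_zero] at h
    linarith
  have hbern := one_add_mul_self_le_rpow_one_add (s := t * P' / (t' * P) - 1) (p := b + 1)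
    (by have : 0 ≤ t * P' / (t' * P) := by positivity
        linarith) (by linarith)
  have hlin : 1 + (b + 1) * (t * P' / (t' * P) - 1) = b * (t - P) / P := by
    have : (b + 1) * P' = b * t' := by linarith
    field_simp
    linear_combination t * this
  rw [hlin, add_sub_cancel, Real.div_rpow (by positivity) (by positivity),
    Real.mul_rpow ht.le hP'.le, Real.mul_rpow ht'pos.le hP.le,
    div_le_div_iff₀ hP (by positivity)] at hbern
  rw [Real.rpow_add_one hP.ne', Real.rpow_add_one hP'.ne'] at hbern
  generalize t ^ (b + 1) = T at *
  generalize t' ^ (b + 1) = T' at *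
  have hQ : 0 < P ^ b := by positivity
  have hQ' : 0 < P' ^ b := by positivity
  generalize P ^ b = Q at *
  generalize P' ^ b = Q' at *
  have key : P' * P * (t - P) * (Q * E') ≤ P' * P * (t - P) * (Q' * E) := by
    calc P' * P * (t - P) * (Q * E') = b * (t - P) * (E' * (t' - P') * (Q * P)) := by
          nth_rewrite 1 [← ht']
          ring
      _ = N * (b * (t - P) * (T' * (Q * P))) := by rw [h']; ring
      _ ≤ N * (T * (Q' * P') * P) := by gcongr
      _ = N * T * (Q' * P' * P) := by ring
      _ ≤ E * (t - P) * (Q' * P' * P) := by gcongr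
      _ = _ := by ring
  exact le_of_mul_le_mul_left key (mul_pos (mul_pos hP' hP) (sub_pos.2 htP))

/-- the Gagliardo–Nirenberg-type inequality with explicit Barenblatt
constant: `(∫ f^p)^{2p/(p−1)} I_p(B) ≤ (∫ B^p)^{2p/(p−1)} I_p(f)`. -/
theorem gagliardo_nirenberg_barenblatt
    (p : ℝ) (hp : 1 < p)
    (f : ℝ → ℝ) (hsmooth : ContDiff ℝ (⊤ : ℕ∞) f) (hpos : ∀ x, 0 < f x)
    (hdecay : RapidDecay f)
    (hfint : Integrable f) (hfmass : (∫ x : ℝ, f x) = 1)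
    (Θ₀ : ℝ) (hΘ₀ : 0 < Θ₀)
    (hfmom_int : Integrable (fun x => x ^ 2 * f x))
    (hfmom : (∫ x : ℝ, x ^ 2 * f x) = Θ₀)
    (C k : ℝ) (hC : 0 < C) (hk : 0 < k)
    (B : ℝ → ℝ) (hB : ∀ y, B y = (max (C - k * y ^ 2) 0) ^ (1 / (p - 1)))
    (hBmass : (∫ y : ℝ, B y) = 1)
    (hBmom : (∫ y : ℝ, y ^ 2 * B y) = Θ₀) :
    (∫ x : ℝ, f x ^ p) ^ (2 * p / (p - 1)) * fisherP p B ≤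
      (∫ y : ℝ, B y ^ p) ^ (2 * p / (p - 1)) * fisherP p f := by

  obtain rfl : B = barenblatt p C k := funext hB
  have hp' : 0 < p - 1 := by linarith
  have hBint : Integrable (barenblatt p C k) := .of_integral_ne_zero (by rw [hBmass]; simp)
  have hB₂int : Integrable fun y => y ^ 2 * barenblatt p C k y :=
    .of_integral_ne_zero (by rw [hBmom]; exact hΘ₀.ne')
  have hpint : Integrable fun x => f x ^ p := hdecay.integrable_rpow hsmooth hpos (by linarith)
  have hP : 0 < ∫ x, f x ^ p :=
    integral_pos_of_integrable_nonneg_nonzero (x := 0)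
      (hsmooth.continuous.rpow_const fun x => Or.inl (hpos x).ne') hpint
      (fun x => (Real.rpow_pos_of_pos (hpos x) p).le) (Real.rpow_pos_of_pos (hpos 0) p).ne'
  obtain ⟨x₀, hx₀⟩ := hsmooth.continuous.exists_forall_ge' 0 <| by
    have h := hdecay 0 0
    simp only [pow_zero, one_mul, iteratedDeriv_zero] at h
    filter_upwards [h.eventually (gt_mem_nhds (hpos 0))] with x hx using le_of_lt hx
  have hPle : ∫ x, f x ^ p ≤ f x₀ ^ (p - 1) := by
    calc ∫ x, f x ^ p ≤ ∫ x, f x₀ ^ (p - 1) * f x := by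
          refine integral_mono hpint (hfint.const_mul _) fun x => ?_
          have hpow : f x ^ p = f x ^ (p - 1) * f x := by
            rw [Real.rpow_sub_one (hpos x).ne', div_mul_cancel₀ _ (hpos x).ne']
          simp only [hpow]
          exact mul_le_mul_of_nonneg_right
            (Real.rpow_le_rpow (hpos x).le (hx₀ x) hp'.le) (hpos x).le
      _ = _ := by rw [integral_const_mul, hfmass, mul_one]
  have hM : 0 < barenblatt p C k 0 := barenblatt_pos (by simpa using hC)
  have hMC : barenblatt p C k 0 ^ (p - 1) = C := by
    simp [barenblatt_rpow_sub_one hp, hC.le]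
  have hsharp := hdecay.le_fisher_mul hp hsmooth hpos hfint hfmass hx₀
  have heq := fisher_barenblatt_mul hp hC hk hBint hBmass hB₂int
  have hCpow := sq_mul_rpow_sub_one_pow hp hM
  rw [hMC] at hCpow
  rw [sq_mul_rpow_sub_one_pow hp (hpos x₀)] at hsharp
  rw [hCpow] at heq
  have hPB := integral_barenblatt_rpow hp hC hk
  have hPB' := integral_barenblatt_rpow_eq_sub hp hBint hB₂int
  rw [hBmom] at hPB hPB'
  rw [hBmass] at hPB'
  have hEB := integral_fisher_barenblatt (C := C) (k := k) hp
  rw [hBmom] at hEB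
  have hopt : 2 * p / (p - 1) * (C - ∫ y, barenblatt p C k y ^ p) =
      ∫ y, barenblatt p C k y ^ p := by
    linear_combination (-(2 * p / (p - 1))) * hPB' - hPB
  have := rpow_mul_le_rpow_mul_of_le_mul_sub (by positivity) hP (by rw [hPB]; positivity)
    (by rw [hEB]; positivity) (Real.rpow_pos_of_pos (hpos x₀) _) hPle hopt hsharp heq
  unfold fisherP
  linarith
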